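/- In Mat_P(ℂ) the identity q²·F0·L − L·F0 + (q^{k/2+1}·K1 + q^{(n−k)/2+1}·K2 − (q+1)·I)·L = 0 holds. -/

import Mathlib

open scoped Classical

noncomputable section

variable {F V : Type} [Field F] [AddCommGroup V] [Module F V]

/-- `v` covers `u` in the projective geometry `P`. -/
def Covers (u v : Submodule F V) : Prop :=
  u ≤ v ∧ Module.finrank F ↥v = Module.finrank F ↥u + 1

/-- `v` slash-covers `u` (relative to the fixed subspace `y`). -/
def SlashCovers (y u v : Submodule F V) : Prop :=
  Covers u v ∧ Module.finrank F ↥(v ⊓ y) = Module.finrank F ↥(u ⊓ y) + 1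

/-- `v` backslash-covers `u` (relative to the fixed subspace `y`). -/
def BackslashCovers (y u v : Submodule F V) : Prop :=
  Covers u v ∧ Module.finrank F ↥(v ⊓ y) = Module.finrank F ↥(u ⊓ y)

/-- `q` raised to a real exponent, as a complex number. -/
def qpow (q : ℕ) (e : ℝ) : ℂ := (((q : ℝ) ^ e : ℝ) : ℂ)

/-- The Gaussian bracket `[m] = (q^m - 1)/(q - 1)` as a rational number. -/
def gaussQ (q m : ℕ) : ℚ := ((q : ℚ) ^ m - 1) / ((q : ℚ) - 1)

/-- The Gaussian bracket `[m] = (q^m - 1)/(q - 1)` as a complex number. -/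
def gaussC (q m : ℕ) : ℂ := ((q : ℂ) ^ m - 1) / ((q : ℂ) - 1)

/-- The diagonal matrix `K1`; the `(u,u)` entry is `q^(k/2 - i)` for `u ∈ P_{i,j}`. -/
def matK1 (q k : ℕ) (y : Submodule F V) : Matrix (Submodule F V) (Submodule F V) ℂ :=
  Matrix.diagonal fun u => qpow q ((k : ℝ) / 2 - (Module.finrank F ↥(u ⊓ y) : ℝ))

/-- The diagonal matrix `K2`; the `(u,u)` entry is `q^(j - (n-k)/2)` for `u ∈ P_{i,j}`. -/
def matK2 (q n k : ℕ) (y : Submodule F V) : Matrix (Submodule F V) (Submodule F V) ℂ :=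
  Matrix.diagonal fun u =>
    qpow q (((Module.finrank F ↥u : ℝ) - (Module.finrank F ↥(u ⊓ y) : ℝ))
      - ((n : ℝ) - (k : ℝ)) / 2)

/-- The 0-1 matrix `L1`; the `(u,v)` entry is `1` iff `v` slash-covers `u`. -/
def matL1 (y : Submodule F V) : Matrix (Submodule F V) (Submodule F V) ℂ :=
  Matrix.of fun u v => if SlashCovers y u v then (1 : ℂ) else 0

/-- The 0-1 matrix `L2`; the `(u,v)` entry is `1` iff `v` backslash-covers `u`. -/
def matL2 (y : Submodule F V) : Matrix (Submodule F V) (Submodule F V) ℂ :=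
  Matrix.of fun u v => if BackslashCovers y u v then (1 : ℂ) else 0

/-- `R1 = L1ᵀ`. -/
def matR1 (y : Submodule F V) : Matrix (Submodule F V) (Submodule F V) ℂ := Matrix.transpose (matL1 y)

/-- `R2 = L2ᵀ`. -/
def matR2 (y : Submodule F V) : Matrix (Submodule F V) (Submodule F V) ℂ := Matrix.transpose (matL2 y)

/-- `R = L1 · R2`. -/
def matR [Fintype (Submodule F V)] (y : Submodule F V) :
    Matrix (Submodule F V) (Submodule F V) ℂ := matL1 y * matR2 y

/-- `L = R1 · L2`. -/
def matL [Fintype (Submodule F V)] (y : Submodule F V) :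
    Matrix (Submodule F V) (Submodule F V) ℂ := matR1 y * matL2 y

/-- The 0-1 matrix `F0`. -/
def matF0 (y : Submodule F V) : Matrix (Submodule F V) (Submodule F V) ℂ :=
  Matrix.of fun u v =>
    if SlashCovers y u (u ⊔ v) ∧ SlashCovers y v (u ⊔ v) ∧
        BackslashCovers y (u ⊓ v) u ∧ BackslashCovers y (u ⊓ v) v then (1 : ℂ) else 0

/-- The 0-1 matrix `F+`. -/
def matFp (y : Submodule F V) : Matrix (Submodule F V) (Submodule F V) ℂ :=
  Matrix.of fun u v =>
    if BackslashCovers y u (u ⊔ v) ∧ BackslashCovers y v (u ⊔ v) then (1 : ℂ) else 0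

/-- The 0-1 matrix `F-`. -/
def matFm (y : Submodule F V) : Matrix (Submodule F V) (Submodule F V) ℂ :=
  Matrix.of fun u v =>
    if SlashCovers y (u ⊓ v) u ∧ SlashCovers y (u ⊓ v) v then (1 : ℂ) else 0

/-- The vertex set `X` of the Grassmann graph: `k`-dimensional subspaces of `V`. -/
abbrev GrassVertex (F V : Type) [Field F] [AddCommGroup V] [Module F V] (k : ℕ) :=
  {z : Submodule F V // Module.finrank F ↥z = k}

/-- The Grassmann graph `J_q(n,k)`: vertices are adjacent iff their intersection
has dimension `k - 1`. -/
def Grass (F V : Type) [Field F] [AddCommGroup V] [Module F V] (k : ℕ) :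
    SimpleGraph (GrassVertex F V k) :=
  SimpleGraph.fromRel fun a b => Module.finrank F ↥(a.1 ⊓ b.1) = k - 1

/-- `B_xy = {z ∈ Γ(x) : ∂(z,y) = ∂(x,y) + 1}`. -/
def Bset {k : ℕ} (x y : GrassVertex F V k) : Set (GrassVertex F V k) :=
  {z | (Grass F V k).Adj x z ∧ (Grass F V k).dist z y = (Grass F V k).dist x y + 1}

/-- `C_xy = {z ∈ Γ(x) : ∂(z,y) = ∂(x,y) - 1}`. -/
def Cset {k : ℕ} (x y : GrassVertex F V k) : Set (GrassVertex F V k) :=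
  {z | (Grass F V k).Adj x z ∧ (Grass F V k).dist z y = (Grass F V k).dist x y - 1}

/-- `A_xy = {z ∈ Γ(x) : ∂(z,y) = ∂(x,y)}`. -/
def Aset {k : ℕ} (x y : GrassVertex F V k) : Set (GrassVertex F V k) :=
  {z | (Grass F V k).Adj x z ∧ (Grass F V k).dist z y = (Grass F V k).dist x y}

/-- `A0_xy`. -/
def A0set {k : ℕ} (x y : GrassVertex F V k) : Set (GrassVertex F V k) :=
  {z | (Grass F V k).Adj x z ∧
    SlashCovers y.1 z.1 (z.1 ⊔ x.1) ∧ SlashCovers y.1 x.1 (z.1 ⊔ x.1) ∧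
    BackslashCovers y.1 (z.1 ⊓ x.1) z.1 ∧ BackslashCovers y.1 (z.1 ⊓ x.1) x.1}

/-- `A+_xy`. -/
def Apset {k : ℕ} (x y : GrassVertex F V k) : Set (GrassVertex F V k) :=
  {z | (Grass F V k).Adj x z ∧
    BackslashCovers y.1 z.1 (z.1 ⊔ x.1) ∧ BackslashCovers y.1 x.1 (z.1 ⊔ x.1)}

/-- `A-_xy`. -/
def Amset {k : ℕ} (x y : GrassVertex F V k) : Set (GrassVertex F V k) :=
  {z | (Grass F V k).Adj x z ∧
    SlashCovers y.1 (z.1 ⊓ x.1) z.1 ∧ SlashCovers y.1 (z.1 ⊓ x.1) x.1}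

/-- The edge `wz` has type `0`. -/
def EdgeType0 {k : ℕ} (y w z : GrassVertex F V k) : Prop :=
  SlashCovers y.1 w.1 (w.1 ⊔ z.1) ∧ SlashCovers y.1 z.1 (w.1 ⊔ z.1) ∧
  BackslashCovers y.1 (w.1 ⊓ z.1) w.1 ∧ BackslashCovers y.1 (w.1 ⊓ z.1) z.1

/-- The edge `wz` has type `+`. -/
def EdgeTypeP {k : ℕ} (y w z : GrassVertex F V k) : Prop :=
  BackslashCovers y.1 w.1 (w.1 ⊔ z.1) ∧ BackslashCovers y.1 z.1 (w.1 ⊔ z.1)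

/-- The edge `wz` has type `-`. -/
def EdgeTypeM {k : ℕ} (y w z : GrassVertex F V k) : Prop :=
  SlashCovers y.1 (w.1 ⊓ z.1) w.1 ∧ SlashCovers y.1 (w.1 ⊓ z.1) z.1

section Helpers

open Module

/-! ### Linear algebra of covers -/

section Covers

variable [FiniteDimensional F V]

theorem Covers.eq_of_le {u v w : Submodule F V} (huv : Covers u v) (huw : Covers u w)
    (h : v ≤ w) : v = w :=
  Submodule.eq_of_le_of_finrank_eq h (huv.2.trans huw.2.symm)

theorem Covers.eq_of_le' {u v w : Submodule F V} (huw : Covers u w) (hvw : Covers v w)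
    (h : u ≤ v) : u = v :=
  Submodule.eq_of_le_of_finrank_eq h (by have := huw.2; have := hvw.2; omega)

theorem Covers.eq_sup {u v w : Submodule F V} (hu : Covers u w) (hv : Covers v w)
    (hne : u ≠ v) : w = u ⊔ v := by
  have hlt : u < u ⊔ v := lt_of_le_of_ne le_sup_left fun h =>
    hne (hv.eq_of_le' hu (h ▸ le_sup_right)).symm
  have h1 := Submodule.finrank_lt_finrank_of_lt hlt
  have h2 := hu.2
  exact (Submodule.eq_of_le_of_finrank_le (sup_le hu.1 hv.1) (by omega)).symm

theorem Covers.eq_inf {u v w : Submodule F V} (hu : Covers w u) (hv : Covers w v)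
    (hne : u ≠ v) : w = u ⊓ v := by
  have hlt : u ⊓ v < u := lt_of_le_of_ne inf_le_left fun h =>
    hne (hu.eq_of_le hv (h ▸ inf_le_right))
  have h1 := Submodule.finrank_lt_finrank_of_lt hlt
  have h2 := hu.2
  exact Submodule.eq_of_le_of_finrank_le (le_inf hu.1 hv.1) (by omega)

theorem finrank_inf_le_of_le (y : Submodule F V) {u v : Submodule F V} (h : u ≤ v) :
    finrank F ↥(u ⊓ y) ≤ finrank F ↥(v ⊓ y) :=
  Submodule.finrank_mono (inf_le_inf_right y h)

theorem Covers.finrank_inf_le {u v : Submodule F V} (h : Covers u v) (y : Submodule F V) :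
    finrank F ↥(v ⊓ y) ≤ finrank F ↥(u ⊓ y) + 1 := by
  have h1 := Submodule.finrank_sup_add_finrank_inf_eq u (v ⊓ y)
  rw [← inf_assoc, inf_eq_left.2 h.1] at h1
  have h2 : finrank F ↥(u ⊔ v ⊓ y) ≤ finrank F ↥v :=
    Submodule.finrank_mono (sup_le h.1 inf_le_left)
  have h3 := h.2
  omega

/-- The dimension of the intersection with `y` is supermodular. -/
theorem finrank_inf_supermodular (y u v : Submodule F V) :
    finrank F ↥(u ⊓ y) + finrank F ↥(v ⊓ y) ≤
      finrank F ↥((u ⊔ v) ⊓ y) + finrank F ↥(u ⊓ v ⊓ y) := by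
  rw [← Submodule.finrank_sup_add_finrank_inf_eq, ← inf_inf_distrib_right]
  gcongr
  exact Submodule.finrank_mono (sup_le (inf_le_inf_right y le_sup_left)
    (inf_le_inf_right y le_sup_right))

/-- Number of covers of `u` inside `t` but not inside `s`, by counting vectors of `t \ s`. -/
theorem card_covers_mul [Fintype F] [Fintype (Submodule F V)] {u s t : Submodule F V}
    (hus : u ≤ s) (hst : s ≤ t) :
    (∑ w, if Covers u w ∧ w ≤ t ∧ ¬ w ≤ s then (1 : ℂ) else 0) *
        ((Fintype.card F : ℂ) ^ (finrank F u + 1) - (Fintype.card F : ℂ) ^ finrank F u) =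
      (Fintype.card F : ℂ) ^ finrank F t - (Fintype.card F : ℂ) ^ finrank F s := by
  have : Finite V := Module.finite_of_finite F
  have := Fintype.ofFinite V
  have hcard (a : Submodule F V) :
      (Finset.univ.filter (· ∈ a)).card = Fintype.card F ^ finrank F a := by
    rw [← Module.card_eq_pow_finrank (K := F) (V := a), ← Fintype.card_subtype]
  have hdiff {a b : Submodule F V} (hab : a ≤ b) :
      ((Finset.univ.filter fun x => x ∈ b ∧ x ∉ a).card : ℂ) =
        (Fintype.card F : ℂ) ^ finrank F b - (Fintype.card F : ℂ) ^ finrank F a := by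
    have h1 : (Finset.univ.filter fun x => x ∈ b ∧ x ∉ a) =
        Finset.univ.filter (· ∈ b) \ Finset.univ.filter (· ∈ a) := by
      ext x; simp
    have h2 : Finset.univ.filter (· ∈ a) ⊆ Finset.univ.filter (· ∈ b) := by
      intro x; simpa using @hab x
    rw [h1, Finset.cast_card_sdiff h2, hcard, hcard]
    push_cast
    rfl
  have key := Finset.card_eq_sum_card_fiberwise
    (s := Finset.univ.filter fun x => x ∈ t ∧ x ∉ s)
    (t := Finset.univ.filter fun w : Submodule F V => Covers u w ∧ w ≤ t ∧ ¬ w ≤ s)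
    (f := fun x => u ⊔ Submodule.span F {x}) (by
      intro x hx
      simp only [Finset.coe_filter, Finset.mem_univ, true_and, Set.mem_ofPred_eq] at hx ⊢
      refine ⟨⟨le_sup_left, ?_⟩, sup_le (hus.trans hst) ?_, fun h => hx.2 (h ?_)⟩
      · exact Submodule.finrank_sup_span_singleton fun h => hx.2 (hus h)
      · simpa using hx.1
      · exact Submodule.mem_sup_right (Submodule.mem_span_singleton_self x))
  have fiber : ∀ w ∈ (Finset.univ.filter fun w : Submodule F V =>
      Covers u w ∧ w ≤ t ∧ ¬ w ≤ s),
      ((Finset.filter (fun x => u ⊔ Submodule.span F {x} = w)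
        (Finset.univ.filter fun x => x ∈ t ∧ x ∉ s)).card : ℂ) =
      (Fintype.card F : ℂ) ^ (finrank F u + 1) - (Fintype.card F : ℂ) ^ finrank F u := by
    intro w hw
    simp only [Finset.mem_filter, Finset.mem_univ, true_and] at hw
    obtain ⟨huw, hwt, hws⟩ := hw
    rw [← huw.2, ← hdiff huw.1, Finset.filter_filter]
    congr 2
    ext x
    simp only [Finset.mem_filter, Finset.mem_univ, true_and]
    constructor
    · rintro ⟨⟨_, hxs⟩, rfl⟩
      exact ⟨Submodule.mem_sup_right (Submodule.mem_span_singleton_self x),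
        fun h => hxs (hus h)⟩
    · rintro ⟨hxw, hxu⟩
      have h : u ⊔ Submodule.span F {x} = w :=
        Covers.eq_of_le ⟨le_sup_left, Submodule.finrank_sup_span_singleton hxu⟩ huw
          (sup_le huw.1 (by simpa using hxw))
      refine ⟨⟨hwt hxw, fun hxs => hws ?_⟩, h⟩
      rw [← h]
      exact sup_le hus (by simpa using hxs)
  have key' := congrArg (Nat.cast : ℕ → ℂ) key
  rw [hdiff hst] at key'
  rw [key', Nat.cast_sum, Finset.sum_congr rfl fiber, Finset.sum_const, nsmul_eq_mul,
    Finset.sum_boole]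

end Covers

/-! ### The dual space -/

section Dual

variable [FiniteDimensional F V]

theorem finrank_dualAnnihilator_inf (u y : Submodule F V) :
    finrank F ↥(u.dualAnnihilator ⊓ y.dualAnnihilator) + finrank F u + finrank F y =
      finrank F V + finrank F ↥(u ⊓ y) := by
  rw [← Submodule.dualAnnihilator_sup_eq]
  have h1 := Subspace.finrank_add_finrank_dualAnnihilator_eq (u ⊔ y)
  have h2 := Submodule.finrank_sup_add_finrank_inf_eq u y
  omega

theorem covers_dualAnnihilator {u v : Submodule F V} :
    Covers v.dualAnnihilator u.dualAnnihilator ↔ Covers u v := by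
  have h1 := Subspace.finrank_add_finrank_dualAnnihilator_eq u
  have h2 := Subspace.finrank_add_finrank_dualAnnihilator_eq v
  simp only [Covers, Subspace.dualAnnihilator_le_dualAnnihilator_iff]
  refine and_congr_right fun _ => ?_
  omega

theorem slashCovers_dualAnnihilator {y u v : Submodule F V} :
    SlashCovers y.dualAnnihilator v.dualAnnihilator u.dualAnnihilator ↔
      BackslashCovers y u v := by
  have h1 := finrank_dualAnnihilator_inf u y
  have h2 := finrank_dualAnnihilator_inf v y
  simp only [SlashCovers, BackslashCovers, covers_dualAnnihilator]
  refine and_congr_right fun h => ?_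
  have := h.2
  omega

theorem backslashCovers_dualAnnihilator {y u v : Submodule F V} :
    BackslashCovers y.dualAnnihilator v.dualAnnihilator u.dualAnnihilator ↔
      SlashCovers y u v := by
  have h1 := finrank_dualAnnihilator_inf u y
  have h2 := finrank_dualAnnihilator_inf v y
  simp only [SlashCovers, BackslashCovers, covers_dualAnnihilator]
  refine and_congr_right fun h => ?_
  have := h.2
  omega

/-- Taking annihilators, as a bijection between subspaces of `V` and of its dual. -/
def annEquiv (F V : Type) [Field F] [AddCommGroup V] [Module F V] [FiniteDimensional F V] :
    Submodule F V ≃ Submodule F (Dual F V) :=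
  Subspace.orderIsoFiniteDimensional.toEquiv.trans OrderDual.ofDual

theorem annEquiv_apply (u : Submodule F V) : annEquiv F V u = u.dualAnnihilator := rfl

theorem finite_submodule_dual [Finite (Submodule F V)] :
    Finite (Submodule F (Dual F V)) := .of_equiv _ (annEquiv F V)

end Dual

/-! ### Counting covers -/

section Counting

variable [FiniteDimensional F V]

theorem Covers.not_le {u w : Submodule F V} (h : Covers u w) : ¬ w ≤ u := fun h' => by
  have h1 := Submodule.finrank_mono (R := F) h'
  have h2 := h.2
  omega

theorem Covers.slashCovers_iff {y u w : Submodule F V} (h : Covers u w) :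
    SlashCovers y u w ↔ w ≤ u ⊔ y := by
  have hmod : u ⊔ w ⊓ y = w ⊓ (u ⊔ y) := by
    rw [inf_comm, ← sup_inf_assoc_of_le _ h.1, inf_comm]
  have h1 := Submodule.finrank_sup_add_finrank_inf_eq u (w ⊓ y)
  rw [← inf_assoc, inf_eq_left.2 h.1, hmod] at h1
  have h2 := h.2
  refine ⟨fun hs => ?_, fun hw => ⟨h, ?_⟩⟩
  · have h3 := hs.2
    exact inf_eq_left.1 (Submodule.eq_of_le_of_finrank_eq inf_le_left (by omega))
  · rw [inf_eq_left.2 hw] at h1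
    omega

theorem Covers.backslashCovers_iff {y u w : Submodule F V} (h : Covers u w) :
    BackslashCovers y u w ↔ ¬ w ≤ u ⊔ y := by
  rw [← h.slashCovers_iff]
  have h1 := h.finrank_inf_le y
  have h2 := finrank_inf_le_of_le y h.1
  simp only [BackslashCovers, SlashCovers, h, true_and]
  omega

variable [Fintype (Submodule F V)]

/-- The number of subspaces that slash-cover `u`. -/
def upSlash (y u : Submodule F V) : ℂ := ∑ w, if SlashCovers y u w then 1 else 0

/-- The number of subspaces that backslash-cover `u`. -/
def upBackslash (y u : Submodule F V) : ℂ := ∑ w, if BackslashCovers y u w then 1 else 0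

/-- The number of subspaces slash-covered by `u`. -/
def downSlash (y u : Submodule F V) : ℂ := ∑ w, if SlashCovers y w u then 1 else 0

/-- The number of subspaces backslash-covered by `u`. -/
def downBackslash (y u : Submodule F V) : ℂ := ∑ w, if BackslashCovers y w u then 1 else 0

variable [Fintype F]

theorem upSlash_mul {y u : Submodule F V} {a : ℕ}
    (ha : a + finrank F ↥(u ⊓ y) = finrank F y) :
    upSlash y u * ((Fintype.card F : ℂ) - 1) = (Fintype.card F : ℂ) ^ a - 1 := by
  have hq : (Fintype.card F : ℂ) ≠ 0 := by simp
  have h := card_covers_mul (F := F) (le_refl u) (le_sup_left : u ≤ u ⊔ y)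
  have hd : finrank F ↥(u ⊔ y) = finrank F u + a := by
    have := Submodule.finrank_sup_add_finrank_inf_eq u y
    omega
  have hs : upSlash y u = ∑ w, if Covers u w ∧ w ≤ u ⊔ y ∧ ¬ w ≤ u then (1 : ℂ) else 0 := by
    refine Finset.sum_congr rfl fun w _ => if_congr ?_ rfl rfl
    exact ⟨fun h => ⟨h.1, h.1.slashCovers_iff.1 h, h.1.not_le⟩,
      fun h => h.1.slashCovers_iff.2 h.2.1⟩
  rw [← hs, hd] at h
  apply mul_left_cancel₀ (pow_ne_zero (finrank F u) hq)
  linear_combination h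

theorem upBackslash_mul {y u : Submodule F V} {a e : ℕ}
    (ha : a + finrank F ↥(u ⊓ y) = finrank F y) (he : e + finrank F u = finrank F V) :
    upBackslash y u * ((Fintype.card F : ℂ) - 1) =
      (Fintype.card F : ℂ) ^ e - (Fintype.card F : ℂ) ^ a := by
  have hq : (Fintype.card F : ℂ) ≠ 0 := by simp
  have h := card_covers_mul (F := F) (le_sup_left : u ≤ u ⊔ y) le_top
  have hd : finrank F ↥(u ⊔ y) = finrank F u + a := by
    have := Submodule.finrank_sup_add_finrank_inf_eq u y
    omega
  have hs : upBackslash y u =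
      ∑ w, if Covers u w ∧ w ≤ ⊤ ∧ ¬ w ≤ u ⊔ y then (1 : ℂ) else 0 := by
    refine Finset.sum_congr rfl fun w _ => if_congr ?_ rfl rfl
    exact ⟨fun h => ⟨h.1, le_top, h.1.backslashCovers_iff.1 h⟩,
      fun h => h.1.backslashCovers_iff.2 h.2.2⟩
  rw [← hs, hd, finrank_top, ← he] at h
  apply mul_left_cancel₀ (pow_ne_zero (finrank F u) hq)
  linear_combination h

theorem downBackslash_mul {y u : Submodule F V} {b : ℕ}
    (hb : b + finrank F ↥(u ⊓ y) = finrank F u) :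
    downBackslash y u * ((Fintype.card F : ℂ) - 1) = (Fintype.card F : ℂ) ^ b - 1 := by
  have := finite_submodule_dual (F := F) (V := V)
  have := Fintype.ofFinite (Submodule F (Dual F V))
  have h1 : downBackslash y u = upSlash y.dualAnnihilator u.dualAnnihilator :=
    Fintype.sum_equiv (annEquiv F V) _ _ fun w => by
      rw [annEquiv_apply]; simp only [slashCovers_dualAnnihilator]
  rw [h1]
  apply upSlash_mul
  have h2 := finrank_dualAnnihilator_inf u y
  have h3 := Subspace.finrank_add_finrank_dualAnnihilator_eq y
  omega

theorem downSlash_mul {y u : Submodule F V} {b : ℕ}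
    (hb : b + finrank F ↥(u ⊓ y) = finrank F u) :
    downSlash y u * ((Fintype.card F : ℂ) - 1) =
      (Fintype.card F : ℂ) ^ finrank F u - (Fintype.card F : ℂ) ^ b := by
  have := finite_submodule_dual (F := F) (V := V)
  have := Fintype.ofFinite (Submodule F (Dual F V))
  have h1 : downSlash y u = upBackslash y.dualAnnihilator u.dualAnnihilator :=
    Fintype.sum_equiv (annEquiv F V) _ _ fun w => by
      rw [annEquiv_apply]; simp only [backslashCovers_dualAnnihilator]
  rw [h1]
  have h2 := finrank_dualAnnihilator_inf u y
  have h3 := Subspace.finrank_add_finrank_dualAnnihilator_eq y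
  have h4 := Subspace.finrank_add_finrank_dualAnnihilator_eq u
  apply upBackslash_mul
  · omega
  · rw [Subspace.dual_finrank_eq]
    omega

theorem card_sub_one_ne_zero : (Fintype.card F : ℂ) - 1 ≠ 0 := by
  rw [sub_ne_zero]
  exact_mod_cast Fintype.one_lt_card.ne'

theorem BackslashCovers.slash_count {y u v : Submodule F V} (h : BackslashCovers y u v) :
    upSlash y v - downSlash y v = Fintype.card F * (upSlash y u - downSlash y u) +
      (1 - (Fintype.card F : ℂ) ^ (finrank F y - finrank F ↥(u ⊓ y))) := by
  have hd := h.1.2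
  have hi := h.2
  have hiy := Submodule.finrank_mono (R := F) (inf_le_right : u ⊓ y ≤ y)
  have hiu := Submodule.finrank_mono (R := F) (inf_le_left : u ⊓ y ≤ u)
  obtain ⟨a, ha⟩ := Nat.exists_eq_add_of_le hiy
  obtain ⟨b, hb⟩ := Nat.exists_eq_add_of_le hiu
  have h1 := upSlash_mul (y := y) (u := u) (a := a) (by omega)
  have h2 := upSlash_mul (y := y) (u := v) (a := a) (by omega)
  have h3 := downSlash_mul (y := y) (u := u) (b := b) (by omega)
  have h4 := downSlash_mul (y := y) (u := v) (b := b + 1) (by omega)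
  rw [hd] at h4
  rw [show finrank F y - finrank F ↥(u ⊓ y) = a by omega]
  apply mul_right_cancel₀ (card_sub_one_ne_zero (F := F))
  linear_combination h2 - h4 - (Fintype.card F : ℂ) * (h1 - h3)

theorem SlashCovers.backslash_count {y u v : Submodule F V} (h : SlashCovers y v u) :
    downBackslash y v - upBackslash y v =
      Fintype.card F * (downBackslash y u - upBackslash y u) +
      (1 - (Fintype.card F : ℂ) ^ (finrank F u - finrank F ↥(u ⊓ y))) := by
  have hd := h.1.2
  have hi := h.2
  have hiy := Submodule.finrank_mono (R := F) (inf_le_right : u ⊓ y ≤ y)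
  have hiu := Submodule.finrank_mono (R := F) (inf_le_left : u ⊓ y ≤ u)
  obtain ⟨a, ha⟩ := Nat.exists_eq_add_of_le hiy
  obtain ⟨b, hb⟩ := Nat.exists_eq_add_of_le hiu
  obtain ⟨e, he⟩ := Nat.exists_eq_add_of_le u.finrank_le
  have h1 := downBackslash_mul (y := y) (u := u) (b := b) (by omega)
  have h2 := downBackslash_mul (y := y) (u := v) (b := b) (by omega)
  have h3 := upBackslash_mul (y := y) (u := u) (a := a) (e := e) (by omega) (by omega)
  have h4 := upBackslash_mul (y := y) (u := v) (a := a + 1) (e := e + 1) (by omega) (by omega)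
  rw [show finrank F u - finrank F ↥(u ⊓ y) = b by omega]
  apply mul_right_cancel₀ (card_sub_one_ne_zero (F := F))
  linear_combination h2 - h4 - (Fintype.card F : ℂ) * (h1 - h3)

end Counting

/-! ### Relations between the raising and lowering matrices -/

theorem SlashCovers.not_backslashCovers {y u w : Submodule F V} (h : SlashCovers y u w) :
    ¬ BackslashCovers y u w := fun h' => by
  have h1 := h.2
  have h2 := h'.2
  omega

section Relations

variable [FiniteDimensional F V]

theorem covers_sup_iff {u v : Submodule F V} : Covers u (u ⊔ v) ↔ Covers (u ⊓ v) v := by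
  have := Submodule.finrank_sup_add_finrank_inf_eq u v
  simp only [Covers, le_sup_left, inf_le_right, true_and]
  omega

theorem covers_sup_iff' {u v : Submodule F V} : Covers v (u ⊔ v) ↔ Covers (u ⊓ v) u := by
  rw [sup_comm, inf_comm, covers_sup_iff]

theorem slash_inf_backslash_inf_iff (y u v : Submodule F V) :
    SlashCovers y (u ⊓ v) u ∧ BackslashCovers y (u ⊓ v) v ↔
      BackslashCovers y u (u ⊔ v) ∧ SlashCovers y v (u ⊔ v) := by
  simp only [SlashCovers, BackslashCovers, covers_sup_iff, covers_sup_iff']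
  by_cases hu : Covers (u ⊓ v) u <;> by_cases hv : Covers (u ⊓ v) v <;>
    simp only [hu, hv, true_and, false_and, and_false]
  have h1 := hu.finrank_inf_le y
  have h2 := hv.finrank_inf_le y
  have h3 := (covers_sup_iff.2 hv).finrank_inf_le y
  have h4 := (covers_sup_iff'.2 hu).finrank_inf_le y
  have h5 := finrank_inf_le_of_le y hu.1
  have h6 := finrank_inf_le_of_le y hv.1
  have h7 := finrank_inf_le_of_le y (le_sup_left : u ≤ u ⊔ v)
  have h8 := finrank_inf_le_of_le y (le_sup_right : v ≤ u ⊔ v)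
  omega

theorem matF0_apply_self (y u : Submodule F V) : matF0 y u u = 0 := by
  rw [matF0, Matrix.of_apply, if_neg]
  rintro ⟨h, -⟩
  exact h.1.not_le (sup_le le_rfl le_rfl)

variable [Fintype (Submodule F V)]

theorem sum_common_upper {S T : Submodule F V → Submodule F V → Prop}
    (hS : ∀ u w, S u w → Covers u w) (hT : ∀ u w, T u w → Covers u w)
    {u v : Submodule F V} (hne : u ≠ v) :
    (∑ w, (if S u w then (1 : ℂ) else 0) * if T v w then (1 : ℂ) else 0) =
      if S u (u ⊔ v) ∧ T v (u ⊔ v) then 1 else 0 := by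
  rw [Finset.sum_eq_single (u ⊔ v), ite_and, ite_mul, one_mul, zero_mul]
  · intro w _ hw
    rw [ite_mul, one_mul, zero_mul, ← ite_and]
    exact if_neg fun h => hw ((hS _ _ h.1).eq_sup (hT _ _ h.2) hne)
  · simp

theorem sum_common_lower {S T : Submodule F V → Submodule F V → Prop}
    (hS : ∀ u w, S u w → Covers u w) (hT : ∀ u w, T u w → Covers u w)
    {u v : Submodule F V} (hne : u ≠ v) :
    (∑ w, (if S w u then (1 : ℂ) else 0) * if T w v then (1 : ℂ) else 0) =
      if S (u ⊓ v) u ∧ T (u ⊓ v) v then 1 else 0 := by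
  rw [Finset.sum_eq_single (u ⊓ v), ite_and, ite_mul, one_mul, zero_mul]
  · intro w _ hw
    rw [ite_mul, one_mul, zero_mul, ← ite_and]
    exact if_neg fun h => hw ((hS _ _ h.1).eq_inf (hT _ _ h.2) hne)
  · simp

theorem matR1_mul_matL2 (y : Submodule F V) : matR1 y * matL2 y = matL2 y * matR1 y := by
  ext u v
  simp only [Matrix.mul_apply, matR1, matL2, matL1, Matrix.transpose_apply, Matrix.of_apply]
  by_cases hne : u = v
  · subst hne
    refine Finset.sum_congr rfl fun w _ => ?_
    have h1 := fun h : SlashCovers y w u => h.not_backslashCovers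
    have h2 := fun h : SlashCovers y u w => h.not_backslashCovers
    split_ifs <;> simp_all
  · rw [sum_common_lower (fun _ _ h => h.1) (fun _ _ h => h.1) hne,
      sum_common_upper (fun _ _ h => h.1) (fun _ _ h => h.1) hne]
    exact if_congr (slash_inf_backslash_inf_iff y u v) rfl rfl

theorem matL1_mul_matR1_sub (y : Submodule F V) :
    matL1 y * matR1 y - matR1 y * matL1 y =
      matF0 y + Matrix.diagonal fun u : Submodule F V => upSlash y u - downSlash y u := by
  ext u v
  rw [Matrix.sub_apply, Matrix.add_apply]
  by_cases hne : u = v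
  · subst hne
    rw [matF0_apply_self, Matrix.diagonal_apply_eq, zero_add]
    simp only [Matrix.mul_apply, matR1, matL1, upSlash, downSlash, Matrix.transpose_apply,
      Matrix.of_apply, mul_ite, mul_one, mul_zero, ← ite_and, and_self]
  · rw [Matrix.diagonal_apply_ne _ hne, add_zero]
    simp only [Matrix.mul_apply, matR1, matL1, matF0, Matrix.transpose_apply, Matrix.of_apply]
    rw [sum_common_lower (fun _ _ h => h.1) (fun _ _ h => h.1) hne,
      sum_common_upper (fun _ _ h => h.1) (fun _ _ h => h.1) hne]
    simp only [SlashCovers, BackslashCovers, covers_sup_iff, covers_sup_iff']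
    by_cases hu : Covers (u ⊓ v) u <;> by_cases hv : Covers (u ⊓ v) v <;>
      simp only [hu, hv, true_and, false_and, and_false, if_false, sub_zero]
    have h1 := hu.finrank_inf_le y
    have h2 := hv.finrank_inf_le y
    have h3 := (covers_sup_iff.2 hv).finrank_inf_le y
    have h4 := finrank_inf_supermodular y u v
    have h5 := finrank_inf_le_of_le y hu.1
    have h6 := finrank_inf_le_of_le y hv.1
    split_ifs <;> first | omega | norm_num

theorem matR2_mul_matL2_sub (y : Submodule F V) :
    matR2 y * matL2 y - matL2 y * matR2 y =
      matF0 y + Matrix.diagonal fun u : Submodule F V => downBackslash y u - upBackslash y u := by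
  ext u v
  rw [Matrix.sub_apply, Matrix.add_apply]
  by_cases hne : u = v
  · subst hne
    rw [matF0_apply_self, Matrix.diagonal_apply_eq, zero_add]
    simp only [Matrix.mul_apply, matR2, matL2, upBackslash, downBackslash, Matrix.transpose_apply,
      Matrix.of_apply, mul_ite, mul_one, mul_zero, ← ite_and, and_self]
  · rw [Matrix.diagonal_apply_ne _ hne, add_zero]
    simp only [Matrix.mul_apply, matR2, matL2, matF0, Matrix.transpose_apply, Matrix.of_apply]
    rw [sum_common_lower (fun _ _ h => h.1) (fun _ _ h => h.1) hne,
      sum_common_upper (fun _ _ h => h.1) (fun _ _ h => h.1) hne]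
    simp only [SlashCovers, BackslashCovers, covers_sup_iff, covers_sup_iff']
    by_cases hu : Covers (u ⊓ v) u <;> by_cases hv : Covers (u ⊓ v) v <;>
      simp only [hu, hv, true_and, false_and, and_false, if_false, sub_zero]
    have h3 := (covers_sup_iff.2 hv).finrank_inf_le y
    have h4 := finrank_inf_supermodular y u v
    have h5 := finrank_inf_le_of_le y hu.1
    have h6 := finrank_inf_le_of_le y hv.1
    split_ifs <;> first | omega | norm_num

variable [Fintype F]

theorem matL2_mul_matL1 (y : Submodule F V) :
    matL2 y * matL1 y = (Fintype.card F : ℂ) • (matL1 y * matL2 y) := by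
  have hq : (Fintype.card F : ℂ) ≠ 0 := by simp
  ext u v
  simp only [Matrix.smul_apply, Matrix.mul_apply, matL1, matL2, Matrix.of_apply, smul_eq_mul,
    ite_mul, one_mul, zero_mul, ← ite_and]
  by_cases h : u ≤ v ∧ finrank F v = finrank F u + 2 ∧
      finrank F ↥(v ⊓ y) = finrank F ↥(u ⊓ y) + 1
  · obtain ⟨huv, hd, hi⟩ := h
    have hst : u ⊔ v ⊓ y ≤ v := sup_le huv inf_le_left
    have hs : finrank F ↥(u ⊔ v ⊓ y) = finrank F u + 1 := by
      have h1 := Submodule.finrank_sup_add_finrank_inf_eq u (v ⊓ y)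
      rw [← inf_assoc, inf_eq_left.2 huv] at h1
      omega
    have hmem {w : Submodule F V} (hw : Covers u w) (hwv : w ≤ v) :
        SlashCovers y u w ↔ w ≤ u ⊔ v ⊓ y := by
      rw [hw.slashCovers_iff, inf_comm v y, ← sup_inf_assoc_of_le _ huv, le_inf_iff]
      exact (and_iff_left hwv).symm
    have hcov {w : Submodule F V} (hw : Covers u w) (hwv : w ≤ v) : Covers w v :=
      ⟨hwv, by have := hw.2; omega⟩
    have h1 : ∀ w, BackslashCovers y u w ∧ SlashCovers y w v ↔
        Covers u w ∧ w ≤ v ∧ ¬ w ≤ u ⊔ v ⊓ y := by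
      intro w
      constructor
      · rintro ⟨h1, h2⟩
        refine ⟨h1.1, h2.1.1, fun h3 => ?_⟩
        exact ((hmem h1.1 h2.1.1).2 h3).not_backslashCovers h1
      · rintro ⟨h1, h2, h3⟩
        have h4 := (not_congr (hmem h1 h2)).2 h3
        rw [h1.slashCovers_iff, ← h1.backslashCovers_iff] at h4
        exact ⟨h4, hcov h1 h2, by have := h4.2; omega⟩
    have h2 : ∀ w, SlashCovers y u w ∧ BackslashCovers y w v ↔
        Covers u w ∧ w ≤ u ⊔ v ⊓ y ∧ ¬ w ≤ u := by
      intro w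
      constructor
      · rintro ⟨h1, h2⟩
        exact ⟨h1.1, (hmem h1.1 h2.1.1).1 h1, h1.1.not_le⟩
      · rintro ⟨h1, h2, -⟩
        have h3 := (hmem h1 (h2.trans hst)).2 h2
        exact ⟨h3, hcov h1 (h2.trans hst), by have := h3.2; omega⟩
    simp only [h1, h2]
    have c1 := card_covers_mul (F := F) (le_sup_left : u ≤ u ⊔ v ⊓ y) hst
    have c2 := card_covers_mul (F := F) (le_refl u) (le_sup_left : u ≤ u ⊔ v ⊓ y)
    rw [hs] at c2
    rw [hs, hd] at c1
    apply mul_right_cancel₀ (mul_ne_zero (pow_ne_zero (finrank F u) hq)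
      (card_sub_one_ne_zero (F := F)))
    linear_combination c1 - (Fintype.card F : ℂ) * c2
  · rw [Finset.sum_eq_zero, Finset.sum_eq_zero, mul_zero]
    · intro w _
      refine if_neg fun hw => h ⟨hw.1.1.1.trans hw.2.1.1, ?_, ?_⟩
      · rw [hw.2.1.2, hw.1.1.2]
      · rw [hw.2.2, hw.1.2]
    · intro w _
      refine if_neg fun hw => h ⟨hw.1.1.1.trans hw.2.1.1, ?_, ?_⟩
      · rw [hw.2.1.2, hw.1.1.2]
      · rw [hw.2.2, hw.1.2]

theorem matR1_mul_matR2 (y : Submodule F V) :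
    matR1 y * matR2 y = (Fintype.card F : ℂ) • (matR2 y * matR1 y) := by
  simpa only [matR1, matR2, Matrix.transpose_mul, Matrix.transpose_smul] using
    congrArg Matrix.transpose (matL2_mul_matL1 y)

theorem matL2_mul_matF0 (y : Submodule F V) :
    matL2 y * matF0 y = (Fintype.card F : ℂ) • (matF0 y * matL2 y) -
      (Matrix.diagonal fun u : Submodule F V =>
        1 - (Fintype.card F : ℂ) ^ (finrank F y - finrank F ↥(u ⊓ y))) *
        matL2 y := by
  have hF : matF0 y = matL1 y * matR1 y - matR1 y * matL1 y -
      Matrix.diagonal fun u : Submodule F V => upSlash y u - downSlash y u := by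
    rw [matL1_mul_matR1_sub, add_sub_cancel_right]
  have h1 : matL2 y * (matL1 y * matR1 y - matR1 y * matL1 y) =
      (Fintype.card F : ℂ) • ((matL1 y * matR1 y - matR1 y * matL1 y) * matL2 y) := by
    rw [mul_sub, sub_mul, ← mul_assoc, ← mul_assoc, matL2_mul_matL1, ← matR1_mul_matL2,
      mul_assoc (matR1 y), matL2_mul_matL1, mul_assoc (matL1 y) (matR1 y), matR1_mul_matL2,
      smul_sub, Matrix.smul_mul, Matrix.mul_smul, mul_assoc, mul_assoc]
  have h2 : matL2 y * (Matrix.diagonal fun u : Submodule F V => upSlash y u - downSlash y u) =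
      (Fintype.card F : ℂ) •
        ((Matrix.diagonal fun u : Submodule F V => upSlash y u - downSlash y u) * matL2 y) +
      (Matrix.diagonal fun u : Submodule F V =>
        1 - (Fintype.card F : ℂ) ^ (finrank F y - finrank F ↥(u ⊓ y))) *
        matL2 y := by
    ext u v
    simp only [Matrix.add_apply, Matrix.smul_apply, Matrix.diagonal_mul, Matrix.mul_diagonal,
      smul_eq_mul, matL2, Matrix.of_apply]
    split_ifs with h
    · rw [h.slash_count]
      ring
    · ring
  rw [hF, mul_sub, h1, h2, sub_mul _ (Matrix.diagonal _), smul_sub]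
  abel

theorem matR1_mul_matF0 (y : Submodule F V) :
    matR1 y * matF0 y = (Fintype.card F : ℂ) • (matF0 y * matR1 y) -
      (Matrix.diagonal fun u : Submodule F V =>
        1 - (Fintype.card F : ℂ) ^ (finrank F u - finrank F ↥(u ⊓ y))) *
        matR1 y := by
  have hF : matF0 y = matR2 y * matL2 y - matL2 y * matR2 y -
      Matrix.diagonal fun u : Submodule F V => downBackslash y u - upBackslash y u := by
    rw [matR2_mul_matL2_sub, add_sub_cancel_right]
  have h1 : matR1 y * (matR2 y * matL2 y - matL2 y * matR2 y) =
      (Fintype.card F : ℂ) • ((matR2 y * matL2 y - matL2 y * matR2 y) * matR1 y) := by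
    rw [mul_sub, sub_mul, ← mul_assoc, ← mul_assoc, matR1_mul_matR2, matR1_mul_matL2,
      mul_assoc (matL2 y), matR1_mul_matR2, mul_assoc (matR2 y) (matL2 y), ← matR1_mul_matL2,
      smul_sub, Matrix.smul_mul, Matrix.mul_smul, mul_assoc, mul_assoc]
  have h2 : matR1 y * (Matrix.diagonal fun u : Submodule F V =>
      downBackslash y u - upBackslash y u) =
      (Fintype.card F : ℂ) •
        ((Matrix.diagonal fun u : Submodule F V => downBackslash y u - upBackslash y u) * matR1 y) +
      (Matrix.diagonal fun u : Submodule F V =>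
        1 - (Fintype.card F : ℂ) ^ (finrank F u - finrank F ↥(u ⊓ y))) *
        matR1 y := by
    ext u v
    simp only [Matrix.add_apply, Matrix.smul_apply, Matrix.diagonal_mul, Matrix.mul_diagonal,
      smul_eq_mul, matR1, matL1, Matrix.transpose_apply, Matrix.of_apply]
    split_ifs with h
    · rw [h.backslash_count]
      ring
    · ring
  rw [hF, mul_sub, h1, h2, sub_mul _ (Matrix.diagonal _), smul_sub]
  abel

theorem matL_mul_matF0 (y : Submodule F V) :
    matL y * matF0 y = (Fintype.card F : ℂ) ^ 2 • (matF0 y * matL y) +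
      (Matrix.diagonal fun u =>
        (Fintype.card F : ℂ) ^ (finrank F y + 1 - finrank F ↥(u ⊓ y)) +
        (Fintype.card F : ℂ) ^ (finrank F u - finrank F ↥(u ⊓ y) + 1) -
        ((Fintype.card F : ℂ) + 1)) * matL y := by
  have h1 : matR1 y * (Matrix.diagonal fun u : Submodule F V =>
        1 - (Fintype.card F : ℂ) ^ (finrank F y - finrank F ↥(u ⊓ y))) =
      (Matrix.diagonal fun u : Submodule F V =>
        1 - (Fintype.card F : ℂ) ^ (finrank F y + 1 - finrank F ↥(u ⊓ y))) * matR1 y := by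
    ext u v
    simp only [Matrix.diagonal_mul, Matrix.mul_diagonal, matR1, matL1, Matrix.transpose_apply,
      Matrix.of_apply]
    split_ifs with h
    · rw [h.2, Nat.add_sub_add_right, mul_comm]
    · ring
  have h2 : (Matrix.diagonal fun u =>
        (Fintype.card F : ℂ) ^ (finrank F y + 1 - finrank F ↥(u ⊓ y)) +
        (Fintype.card F : ℂ) ^ (finrank F u - finrank F ↥(u ⊓ y) + 1) -
        ((Fintype.card F : ℂ) + 1)) =
      -((Fintype.card F : ℂ) • (Matrix.diagonal fun u : Submodule F V =>
        1 - (Fintype.card F : ℂ) ^ (finrank F u - finrank F ↥(u ⊓ y)))) -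
      Matrix.diagonal fun u : Submodule F V =>
        1 - (Fintype.card F : ℂ) ^ (finrank F y + 1 - finrank F ↥(u ⊓ y)) := by
    rw [← Matrix.diagonal_smul, Matrix.diagonal_neg, Matrix.diagonal_sub]
    congr 1
    ext u
    simp only [Pi.smul_apply, smul_eq_mul]
    ring
  rw [h2, matL, mul_assoc, matL2_mul_matF0, mul_sub, ← mul_assoc, h1, Matrix.mul_smul,
    ← mul_assoc, matR1_mul_matF0]
  simp only [sub_mul, neg_mul, smul_sub, Matrix.smul_mul, smul_smul, mul_assoc, sq]
  abel

end Relations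

end Helpers

theorem statement3
    (q n k : ℕ) (hq : IsPrimePow q) (hkn : k < n) (hk : 1 ≤ k)
    (F V : Type) [Field F] [Fintype F] (hcard : Fintype.card F = q)
    [AddCommGroup V] [Module F V] [FiniteDimensional F V]
    (hdim : Module.finrank F V = n)
    [Fintype (Submodule F V)]
    (y : Submodule F V) (hy : Module.finrank F ↥y = k) :
    (q : ℂ) ^ 2 • (matF0 y * matL y) - matL y * matF0 y +
      (qpow q ((k : ℝ) / 2 + 1) • matK1 q k y + qpow q (((n : ℝ) - (k : ℝ)) / 2 + 1) • matK2 q n k y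
        - ((q : ℂ) + 1) • (1 : Matrix (Submodule F V) (Submodule F V) ℂ)) * matL y = 0 := by
  subst hcard hdim hy
  have hq0 : (0 : ℝ) < Fintype.card F := by exact_mod_cast Fintype.card_pos
  have hmul (a b : ℝ) (c : ℕ) (h : a + b = c) :
      qpow (Fintype.card F) a * qpow (Fintype.card F) b = (Fintype.card F : ℂ) ^ c := by
    rw [qpow, qpow, ← Complex.ofReal_mul, ← Real.rpow_add hq0, h, Real.rpow_natCast]
    push_cast
    rfl
  have hdiag : qpow (Fintype.card F) ((Module.finrank F y : ℝ) / 2 + 1) •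
        matK1 (Fintype.card F) (Module.finrank F y) y +
      qpow (Fintype.card F) (((Module.finrank F V : ℝ) - (Module.finrank F y : ℝ)) / 2 + 1) •
        matK2 (Fintype.card F) (Module.finrank F V) (Module.finrank F y) y -
      ((Fintype.card F : ℂ) + 1) • (1 : Matrix (Submodule F V) (Submodule F V) ℂ) =
      Matrix.diagonal fun u =>
        (Fintype.card F : ℂ) ^ (Module.finrank F y + 1 - Module.finrank F ↥(u ⊓ y)) +
        (Fintype.card F : ℂ) ^ (Module.finrank F u - Module.finrank F ↥(u ⊓ y) + 1) -
        ((Fintype.card F : ℂ) + 1) := by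
    rw [matK1, matK2, ← Matrix.diagonal_one, ← Matrix.diagonal_smul, ← Matrix.diagonal_smul,
      ← Matrix.diagonal_smul, Matrix.diagonal_add, Matrix.diagonal_sub]
    congr 1
    ext u
    have hiy := Submodule.finrank_mono (R := F) (inf_le_right : u ⊓ y ≤ y)
    have hiu := Submodule.finrank_mono (R := F) (inf_le_left : u ⊓ y ≤ u)
    simp only [Pi.smul_apply, smul_eq_mul, mul_one]
    rw [hmul _ _ (Module.finrank F y + 1 - Module.finrank F ↥(u ⊓ y)),
      hmul _ _ (Module.finrank F u - Module.finrank F ↥(u ⊓ y) + 1)]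
    · push_cast [Nat.cast_sub hiu]
      ring
    · rw [Nat.cast_sub (by omega)]
      push_cast
      ring
  rw [hdiag, matL_mul_matF0]
  abel
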